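/- Let v > 0 and let ψ : (−π/√(2v), π/√(2v)) → ℝ be twice differentiable with ψ(0) = 0, ψ′(0) = 1, and ψ″(r) = v · ψ′(r) · ψ(r) for all r in this interval. Then ψ(r) = √(2/v) · tan(r · √(v/2)) for all r ∈ (−π/√(2v), π/√(2v)). -/

import Mathlib

theorem const_aux (c : ℝ) (hc : 0 < c) (f f' : ℝ → ℝ)
    (hf : ∀ r ∈ Set.Ioo (-c) c, HasDerivAt f (f' r) r)
    (hz : ∀ r ∈ Set.Ioo (-c) c, f' r = 0) : ∀ r ∈ Set.Ioo (-c) c, f r = f 0 := by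
  intro r hr
  refine isOpen_Ioo.is_const_of_deriv_eq_zero isPreconnected_Ioo
    (fun x hx => (hf x hx).differentiableAt.differentiableWithinAt) ?_ hr ?_
  · intro x hx
    rw [(hf x hx).deriv, hz x hx]; rfl
  · constructor <;> linarith

/-- if `ψ` is twice differentiable on `(-π/√(2v), π/√(2v))` with
`ψ(0) = 0`, `ψ'(0) = 1` and `ψ'' = v ψ' ψ` there, then
`ψ(r) = √(2/v) tan(r √(v/2))` on that interval. -/
theorem stmt_17 (v : ℝ) (hv : 0 < v) (ψ ψ' ψ'' : ℝ → ℝ)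
    (hd1 : ∀ r ∈ Set.Ioo (-(Real.pi / Real.sqrt (2 * v))) (Real.pi / Real.sqrt (2 * v)),
      HasDerivAt ψ (ψ' r) r)
    (hd2 : ∀ r ∈ Set.Ioo (-(Real.pi / Real.sqrt (2 * v))) (Real.pi / Real.sqrt (2 * v)),
      HasDerivAt ψ' (ψ'' r) r)
    (h0 : ψ 0 = 0) (h1 : ψ' 0 = 1)
    (hode : ∀ r ∈ Set.Ioo (-(Real.pi / Real.sqrt (2 * v))) (Real.pi / Real.sqrt (2 * v)),
      ψ'' r = v * ψ' r * ψ r) :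
    ∀ r ∈ Set.Ioo (-(Real.pi / Real.sqrt (2 * v))) (Real.pi / Real.sqrt (2 * v)),
      ψ r = Real.sqrt (2 / v) * Real.tan (r * Real.sqrt (v / 2)) := by
  have hc : 0 < Real.pi / Real.sqrt (2 * v) := by
    have := Real.pi_pos
    positivity
  generalize Real.pi / Real.sqrt (2 * v) = c at *
  have ha : 0 < Real.sqrt (v / 2) := by positivity
  have ha2 : Real.sqrt (v / 2) ^ 2 = v / 2 := Real.sq_sqrt (by positivity)
  have hinv : Real.sqrt (2 / v) = (Real.sqrt (v / 2))⁻¹ := by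
    rw [← Real.sqrt_inv, inv_div]
  rw [hinv]
  generalize Real.sqrt (v / 2) = a at *
  have hE : ∀ r ∈ Set.Ioo (-c) c, ψ' r = 1 + (a * ψ r) ^ 2 := by
    intro r hr
    have := const_aux c hc (fun x => ψ' x - (a * ψ x) ^ 2) _
      (fun x hx => (hd2 x hx).sub (((hd1 x hx).const_mul a).pow 2))
      (fun x hx => by
        rw [hode x hx]
        have : v = 2 * a ^ 2 := by linarith
        rw [this]; push_cast; ring) r hr
    simp only [h0, h1] at this
    linarith
  intro r hr
  have := const_aux c hc (fun x => Real.arctan (a * ψ x) - x * a) _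
    (fun x hx => (((hd1 x hx).const_mul a).arctan).sub ((hasDerivAt_id x).mul_const a))
    (fun x hx => by
      rw [hE x hx]
      have : 1 + (a * ψ x) ^ 2 ≠ 0 := by positivity
      field_simp
      ring) r hr
  simp only [h0, mul_zero, Real.arctan_zero, zero_mul, sub_zero] at this
  have h2 : r * a = Real.arctan (a * ψ r) := by linarith
  rw [h2, Real.tan_arctan]
  field_simp
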